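/- For every integer k ≥ 0, Λ_k ⊆ co-Λ_{k+1}. -/

import Mathlib

/-!
Distributed decision in the LOCAL model: configurations, local algorithms,
the local hierarchy Σ_k / Π_k / Λ_k and co-Λ_k.
-/

/-- A configuration: a finite connected simple graph on `Fin n` (with `n ≥ 1`)
together with an input bit string at each node. -/
structure Config where
  n : ℕ
  npos : 0 < n
  G : SimpleGraph (Fin n)
  conn : G.Connected
  x : Fin n → List Bool

/-- The ball of radius `t` around `v`: all nodes at distance at most `t`. -/
def ball (C : Config) (v : Fin C.n) (t : ℕ) : Set (Fin C.n) :=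
  {u | C.G.dist v u ≤ t}

lemma self_mem_ball (C : Config) (v : Fin C.n) (t : ℕ) : v ∈ ball C v t := by
  simp [ball, SimpleGraph.dist_self]

/-- A `t`-round local algorithm: at each node it outputs a bit, computed from the whole
configuration, identity assignment and labellings, subject to locality: the output at `v`
only depends on the ball of radius `t` around `v` together with the inputs, identities and
labellings on it (isomorphic labelled balls give equal outputs). -/
structure LocalAlg where
  t : ℕ
  run : (C : Config) → (Fin C.n → ℕ) → (ℕ → Fin C.n → List Bool) → Fin C.n → Bool
  isLocal : ∀ (C C' : Config) (ident : Fin C.n → ℕ) (ident' : Fin C'.n → ℕ)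
      (ℓ : ℕ → Fin C.n → List Bool) (ℓ' : ℕ → Fin C'.n → List Bool)
      (v : Fin C.n) (v' : Fin C'.n)
      (φ : (C.G.induce (ball C v t)) ≃g (C'.G.induce (ball C' v' t))),
      ((φ ⟨v, self_mem_ball C v t⟩).val = v') →
      (∀ u : ball C v t, C'.x (φ u).val = C.x u.val) →
      (∀ u : ball C v t, ident' (φ u).val = ident u.val) →
      (∀ (i : ℕ) (u : ball C v t), ℓ' i (φ u).val = ℓ i u.val) →
      run C ident ℓ v = run C' ident' ℓ' v'

/-- A labelling of size `c · log₂ n`. -/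
def goodLabel (c : ℕ) (C : Config) (ℓ : Fin C.n → List Bool) : Prop :=
  ∀ v, (ℓ v).length ≤ c * Nat.log 2 C.n

/-- Alternating quantification over `j` further labellings (stored at indices `i, i+1, …`),
starting with an existential quantifier when the `Bool` argument is `true` and with a
universal quantifier when it is `false`; `P` is the final predicate. -/
def altQ (c : ℕ) (C : Config) (P : (ℕ → Fin C.n → List Bool) → Prop) :
    ℕ → ℕ → Bool → (ℕ → Fin C.n → List Bool) → Prop
  | 0, _, _, ℓs => P ℓs
  | j + 1, i, true, ℓs =>
      ∃ ℓ, goodLabel c C ℓ ∧ altQ c C P j (i + 1) false (Function.update ℓs i ℓ)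
  | j + 1, i, false, ℓs =>
      ∀ ℓ, goodLabel c C ℓ → altQ c C P j (i + 1) true (Function.update ℓs i ℓ)

/-- Global acceptance: every node outputs 1. -/
def accepts (A : LocalAlg) (C : Config) (ident : Fin C.n → ℕ)
    (ℓs : ℕ → Fin C.n → List Bool) : Prop :=
  ∀ v, A.run C ident ℓs v = true

/-- The empty collection of labellings. -/
def noLabels (C : Config) : ℕ → Fin C.n → List Bool := fun _ _ => []

/-- Inputs are bounded by `α · log₂ n` bits. -/
def BoundedInput (α : ℕ) (C : Config) : Prop :=
  ∀ v, (C.x v).length ≤ α * Nat.log 2 C.n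

/-- An identity assignment: injective, with values in `{1, …, n^β}`. -/
def IsIdAssignment (β : ℕ) (C : Config) (ident : Fin C.n → ℕ) : Prop :=
  Function.Injective ident ∧ ∀ v, 1 ≤ ident v ∧ ident v ≤ C.n ^ β

/-- The class `Σ_k` (with input-size constant `α` and identity-space constant `β`):
`(G,x) ∈ L ⟺ ∃ℓ₁ ∀ℓ₂ … Q ℓ_k`, `A` accepts, for every identity assignment. -/
def SigmaC (α β k : ℕ) (L : Set Config) : Prop :=
  ∃ (A : LocalAlg) (c : ℕ), ∀ C : Config, BoundedInput α C →
    ∀ ident : Fin C.n → ℕ, IsIdAssignment β C ident →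
      (C ∈ L ↔ altQ c C (accepts A C ident) k 0 true (noLabels C))

/-- The class `Π_k`: as `Σ_k` but the alternation starts with a universal quantifier. -/
def PiC (α β k : ℕ) (L : Set Config) : Prop :=
  ∃ (A : LocalAlg) (c : ℕ), ∀ C : Config, BoundedInput α C →
    ∀ ident : Fin C.n → ℕ, IsIdAssignment β C ident →
      (C ∈ L ↔ altQ c C (accepts A C ident) k 0 false (noLabels C))

/-- `Λ_k := Σ_k` for odd `k`, `Λ_k := Π_k` for even `k` (so `Λ_0 = LD`). -/
def LambdaC (α β k : ℕ) (L : Set Config) : Prop :=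
  if k % 2 = 1 then SigmaC α β k L else PiC α β k L

/-- `co-Λ_k`: the complement (within the set of all configurations) is in `Λ_k`. -/
def coLambdaC (α β k : ℕ) (L : Set Config) : Prop :=
  LambdaC α β k ({C : Config | BoundedInput α C} \ L)

/-- Input-preserving isomorphism of configurations. -/
def ConfigIso (C C' : Config) : Prop :=
  ∃ φ : C.G ≃g C'.G, ∀ v, C'.x (φ v) = C.x v

/-- A distributed language: a set of configurations (with bounded inputs)
closed under input-preserving isomorphism. -/
def IsDistLang (α : ℕ) (L : Set Config) : Prop :=
  (∀ C ∈ L, BoundedInput α C) ∧ ∀ C C', ConfigIso C C' → (C ∈ L ↔ C' ∈ L)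

/-- The leading quantifier of `Λ_k`: existential iff `k` is odd. -/
def startEx (k : ℕ) : Bool := decide (k % 2 = 1)

open Classical in
/-- The sum of the values of `s` over all `u` with `R u v`. -/
noncomputable def relSum {V : Type*} [Fintype V] (R : V → V → Prop) (s : V → ℕ) (v : V) : ℕ :=
  ∑ u with R u v, s u

/-- Root weights in a parent structure whose sizes satisfy the subtree-size recursion add up to
the number of nodes. -/
lemma sum_roots_eq_card {V : Type*} [Fintype V] [DecidableEq V] (isRoot : V → Prop)
    [DecidablePred isRoot] (p : V → V) (s : V → ℕ)
    (hs : ∀ v, s v = 1 + relSum (fun u v => ¬ isRoot u ∧ p u = v) s v) :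
    ∑ v with isRoot v, s v = Fintype.card V := by
  classical
  have h1 : ∑ v, s v = Fintype.card V + ∑ v with ¬ isRoot v, s v := by
    rw [Finset.sum_congr rfl fun v _ => hs v, Finset.sum_add_distrib]
    congr 1
    · simp
    · simp only [relSum]
      rw [← Finset.sum_fiberwise (Finset.univ.filter fun v => ¬ isRoot v) p s]
      refine Finset.sum_congr rfl fun v _ => ?_
      rw [Finset.filter_filter]
  have h2 := Finset.sum_filter_add_sum_filter_not Finset.univ isRoot s
  omega

/-- A function satisfying the subtree-size recursion exists whenever a bounded height function
increases from parents to children. -/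
lemma exists_subtreeSize {V : Type*} [Fintype V] (R : V → V → Prop) (d : V → ℕ)
    (hd : ∀ u v, R u v → d v < d u) : ∃ s : V → ℕ, ∀ v, s v = 1 + relSum R s v := by
  classical
  have key : ∀ m, ∃ s : V → ℕ,
      ∀ v, (∑ u, d u) < d v + m → s v = 1 + relSum R s v := by
    intro m
    induction m with
    | zero =>
      refine ⟨fun _ => 0, fun v hv => ?_⟩
      have := Finset.single_le_sum (f := d) (fun _ _ => Nat.zero_le _) (Finset.mem_univ v)
      omega
    | succ m ih =>
      obtain ⟨s, hs⟩ := ih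
      refine ⟨fun v => 1 + relSum R s v, fun v hv => ?_⟩
      simp only [relSum, Nat.add_left_cancel_iff] at hs ⊢
      refine Finset.sum_congr rfl fun u hu => hs u ?_
      have := hd u v (Finset.mem_filter.mp hu).2
      omega
  obtain ⟨s, hs⟩ := key (∑ u, d u + 1)
  exact ⟨s, fun v => hs v (by omega)⟩

lemma exists_adj_dist_lt {V : Type*} {G : SimpleGraph V} (hG : G.Connected) {r v : V}
    (h : v ≠ r) : ∃ w, G.Adj v w ∧ G.dist r w + 1 = G.dist r v := by
  obtain ⟨q, hq⟩ := hG.exists_walk_length_eq_dist v r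
  cases q with
  | nil => exact absurd rfl h
  | @cons _ w _ hw q =>
    refine ⟨w, hw, ?_⟩
    have h1 := SimpleGraph.dist_le q
    have h2 := hG.dist_triangle (u := v) (v := w) (w := r)
    rw [SimpleGraph.dist_eq_one_iff_adj.mpr hw] at h2
    rw [SimpleGraph.Walk.length_cons] at hq
    rw [SimpleGraph.dist_comm (u := r) (v := w), SimpleGraph.dist_comm (u := r) (v := v)]
    omega

/-- Every connected graph has a spanning tree with prescribed root, given by a parent map together
with the subtree sizes. -/
lemma exists_rootedTree {V : Type*} [Fintype V] {G : SimpleGraph V} (hG : G.Connected)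
    (r : V) : ∃ (p : V → V) (s : V → ℕ), (∀ v, v ≠ r → G.Adj v (p v)) ∧
      (∀ v, s v = 1 + relSum (fun u v => u ≠ r ∧ p u = v) s v) ∧
      (∀ v, s v ≤ Fintype.card V) ∧ s r = Fintype.card V := by
  classical
  choose! p hp using fun v (h : v ≠ r) => exists_adj_dist_lt hG h
  obtain ⟨s, hs⟩ := exists_subtreeSize (fun u v => u ≠ r ∧ p u = v) (G.dist r) (by
    rintro u _ ⟨hu, rfl⟩
    have := (hp u hu).2
    omega)
  have hr : s r = Fintype.card V := by
    have hsum := sum_roots_eq_card (· = r) p s hs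
    rwa [show (Finset.univ.filter (· = r)) = {r} by ext; simp, Finset.sum_singleton] at hsum
  refine ⟨p, s, fun v hv => (hp v hv).1, hs, fun v => ?_, hr⟩
  rw [← hr]
  induction hd : G.dist r v generalizing v with
  | zero => rw [hG.dist_eq_zero_iff.mp hd]
  | succ m ih =>
    have hv : v ≠ r := by
      rintro rfl
      simp at hd
    refine le_trans ?_ (ih (p v) (by have := (hp v hv).2; omega))
    rw [hs (p v)]
    have : s v ≤ relSum (fun u w => u ≠ r ∧ p u = w) s (p v) :=
      Finset.single_le_sum (f := s) (fun _ _ => Nat.zero_le _) (by simp [hv])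
    omega

/-- Isomorphisms between balls do not increase the distance to the centre. -/
lemma dist_ballIso_le {C C' : Config} {v : Fin C.n} {v' : Fin C'.n} {t : ℕ}
    (φ : (C.G.induce (ball C v t)) ≃g (C'.G.induce (ball C' v' t)))
    (hφ : (φ ⟨v, self_mem_ball C v t⟩).val = v') (u : ball C v t) :
    C'.G.dist v' (φ u).val ≤ C.G.dist v u.val := by
  obtain ⟨u, hu⟩ := u
  induction hd : C.G.dist v u generalizing u with
  | zero =>
    obtain rfl := C.conn.dist_eq_zero_iff.mp hd
    simp [hφ]
  | succ m ih =>
    have huv : u ≠ v := by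
      rintro rfl
      simp at hd
    obtain ⟨w, hw, hdw⟩ := exists_adj_dist_lt C.conn huv
    have hut : C.G.dist v u ≤ t := hu
    have hwt : w ∈ ball C v t := by
      change C.G.dist v w ≤ t
      omega
    have h1 := ih w hwt (by omega)
    have h2 : C'.G.Adj (φ ⟨w, hwt⟩).val (φ ⟨u, hu⟩).val :=
      φ.map_rel_iff.mpr (show C.G.Adj w u from hw.symm)
    have h3 := C'.conn.dist_triangle (u := v') (v := (φ ⟨w, hwt⟩).val) (w := (φ ⟨u, hu⟩).val)
    rw [SimpleGraph.dist_eq_one_iff_adj.mpr h2] at h3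
    change _ ≤ m + 1
    omega

lemma ball_mono (C : Config) (v : Fin C.n) {t t' : ℕ} (h : t ≤ t') :
    ball C v t ⊆ ball C v t' :=
  fun _ hu => le_trans hu h

/-- An isomorphism between balls restricts to an isomorphism between smaller balls. -/
lemma exists_ballIso_restrict {C C' : Config} {v : Fin C.n} {v' : Fin C'.n} {t t' : ℕ}
    (htt : t ≤ t') (φ : (C.G.induce (ball C v t')) ≃g (C'.G.induce (ball C' v' t')))
    (hφ : (φ ⟨v, self_mem_ball C v t'⟩).val = v') :
    ∃ ψ : (C.G.induce (ball C v t)) ≃g (C'.G.induce (ball C' v' t)),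
      ∀ u : ball C v t, (ψ u).val = (φ ⟨u.val, ball_mono C v htt u.2⟩).val := by
  have hφ' : (φ.symm ⟨v', self_mem_ball C' v' t'⟩).val = v := by
    have : φ.symm ⟨v', self_mem_ball C' v' t'⟩ = ⟨v, self_mem_ball C v t'⟩ := by
      rw [RelIso.symm_apply_eq]
      exact Subtype.ext hφ.symm
    rw [this]
  refine ⟨⟨⟨fun u => ⟨(φ ⟨u.val, ball_mono C v htt u.2⟩).val,
      (dist_ballIso_le φ hφ _).trans u.2⟩,
    fun u => ⟨(φ.symm ⟨u.val, ball_mono C' v' htt u.2⟩).val,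
      (dist_ballIso_le φ.symm hφ' _).trans u.2⟩, fun u => ?_, fun u => ?_⟩, ?_⟩, fun u => rfl⟩
  · simp
  · simp
  · intro a b
    exact φ.map_rel_iff (a := ⟨a.val, ball_mono C v htt a.2⟩)
      (b := ⟨b.val, ball_mono C v htt b.2⟩)

/-- The content of a certificate: root identity, parent identity and subtree size, all positive. -/
def certCode (a b s : ℕ) : List Bool :=
  Nat.bits (Nat.pair (Nat.pair (a - 1) (b - 1)) (s - 1))

/-- Decoding of a bit string as a natural number, inverse to `Nat.bits`. -/
noncomputable def unbits : List Bool → ℕ := Function.invFun Nat.bits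

lemma unbits_bits (m : ℕ) : unbits m.bits = m :=
  Function.leftInverse_invFun (Function.LeftInverse.injective (g := fun l =>
    l.foldr (fun b m => Nat.bit b m) 0) (fun m => by
      induction m using Nat.binaryRec' with
      | zero => simp
      | bit b m h ih => simp only [Nat.bits_append_bit m b h, List.foldr_cons, ih])) m

/-- The root identity recorded in a certificate. -/
noncomputable def certRoot (w : List Bool) : ℕ := (unbits w).unpair.1.unpair.1 + 1

/-- The parent identity recorded in a certificate. -/
noncomputable def certParent (w : List Bool) : ℕ := (unbits w).unpair.1.unpair.2 + 1

/-- The subtree size recorded in a certificate. -/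
noncomputable def certSize (w : List Bool) : ℕ := (unbits w).unpair.2 + 1

lemma certRoot_certCode {a : ℕ} (b s : ℕ) (ha : 1 ≤ a) : certRoot (certCode a b s) = a := by
  simp [certRoot, certCode, unbits_bits, ha]

lemma certParent_certCode (a : ℕ) {b : ℕ} (s : ℕ) (hb : 1 ≤ b) :
    certParent (certCode a b s) = b := by
  simp [certParent, certCode, unbits_bits, hb]

lemma certSize_certCode (a b : ℕ) {s : ℕ} (hs : 1 ≤ s) : certSize (certCode a b s) = s := by
  simp [certSize, certCode, unbits_bits, hs]

lemma Nat.pair_lt_sq {a b m : ℕ} (ha : a < m) (hb : b < m) : Nat.pair a b < m ^ 2 :=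
  (Nat.pair_lt_max_add_one_sq a b).trans_le (Nat.pow_le_pow_left (by omega) 2)

lemma length_certCode_le {n β a b s : ℕ} (hn : 0 < n) (ha : a ≤ n ^ β) (hb : b ≤ n ^ β)
    (hs : s ≤ n ^ β) : (certCode a b s).length ≤ 8 * β * Nat.log 2 n := by
  have hpos : 0 < n ^ β := Nat.pow_pos hn
  have h1 := Nat.pair_lt_sq (show a - 1 < n ^ β by omega) (show b - 1 < n ^ β by omega)
  have h2 : s - 1 < (n ^ β) ^ 2 := by nlinarith [show s - 1 < n ^ β by omega]
  have h3 := Nat.pair_lt_sq h1 h2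
  rw [certCode, Nat.size_eq_bits_len, Nat.size_le]
  refine h3.trans_le ?_
  rw [← pow_mul, ← pow_mul]
  obtain rfl | hn2 : n = 1 ∨ 2 ≤ n := by omega
  · simp
  · have h4 : n ≤ 2 ^ (2 * Nat.log 2 n) := by
      refine (Nat.lt_pow_succ_log_self one_lt_two n).le.trans (Nat.pow_le_pow_right two_pos ?_)
      have := Nat.log_pos one_lt_two hn2
      omega
    calc n ^ (β * (2 * 2)) ≤ (2 ^ (2 * Nat.log 2 n)) ^ (β * (2 * 2)) := Nat.pow_le_pow_left h4 _
      _ = 2 ^ (8 * β * Nat.log 2 n) := by rw [← pow_mul]; ring_nf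

/-- Truncate the first `k` labellings to `m` bits and erase the others. -/
def truncLabels {V : Type*} (k m : ℕ) (ℓs : ℕ → V → List Bool) : ℕ → V → List Bool :=
  fun i u => if i < k then (ℓs i u).take m else []

/-- The condition verified at `v` by the rejection-certifying algorithm: the labelling of index `k`
is locally a rooted spanning tree with subtree sizes, and `A` rejects at the root when
labels are truncated according to the number of nodes, which the root reads off its label. -/
def certOK (A : LocalAlg) (c k : ℕ) (C : Config) (ident : Fin C.n → ℕ)
    (ℓs : ℕ → Fin C.n → List Bool) (v : Fin C.n) : Prop :=
  (∀ u, C.G.Adj v u → certRoot (ℓs k u) = certRoot (ℓs k v)) ∧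
  (ident v ≠ certRoot (ℓs k v) → ∃ u, C.G.Adj v u ∧ ident u = certParent (ℓs k v)) ∧
  certSize (ℓs k v) = 1 + relSum (fun u v => C.G.Adj v u ∧ ident u ≠ certRoot (ℓs k u) ∧
    certParent (ℓs k u) = ident v) (fun u => certSize (ℓs k u)) v ∧
  (ident v = certRoot (ℓs k v) →
    A.run C ident (truncLabels k (c * Nat.log 2 (certSize (ℓs k v))) ℓs) v = false)

lemma mem_ball_of_adj {C : Config} {v u : Fin C.n} {t : ℕ} (ht : 1 ≤ t) (h : C.G.Adj v u) :
    u ∈ ball C v t :=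
  (SimpleGraph.dist_eq_one_iff_adj.mpr h).le.trans ht

lemma certOK_of_ballIso (A : LocalAlg) (c k : ℕ) (C C' : Config) (ident : Fin C.n → ℕ)
    (ident' : Fin C'.n → ℕ) (ℓ : ℕ → Fin C.n → List Bool) (ℓ' : ℕ → Fin C'.n → List Bool)
    (v : Fin C.n) (v' : Fin C'.n)
    (φ : (C.G.induce (ball C v (A.t + 1))) ≃g (C'.G.induce (ball C' v' (A.t + 1))))
    (hv : (φ ⟨v, self_mem_ball C v (A.t + 1)⟩).val = v')
    (hx : ∀ u : ball C v (A.t + 1), C'.x (φ u).val = C.x u.val)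
    (hid : ∀ u : ball C v (A.t + 1), ident' (φ u).val = ident u.val)
    (hl : ∀ (i : ℕ) (u : ball C v (A.t + 1)), ℓ' i (φ u).val = ℓ i u.val)
    (h : certOK A c k C ident ℓ v) : certOK A c k C' ident' ℓ' v' := by
  classical
  have hadj : ∀ u : ball C v (A.t + 1), C'.G.Adj v' (φ u).val ↔ C.G.Adj v u.val := by
    intro u
    have := φ.map_rel_iff (a := ⟨v, self_mem_ball C v (A.t + 1)⟩) (b := u)
    rwa [SimpleGraph.comap_adj, SimpleGraph.comap_adj, Function.Embedding.subtype_apply,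
      Function.Embedding.subtype_apply, hv] at this
  have hlift : ∀ u', C'.G.Adj v' u' → ∃ u : ball C v (A.t + 1), C.G.Adj v u.val ∧
      (φ u).val = u' := by
    intro u' hu'
    obtain ⟨u, hu⟩ := φ.surjective ⟨u', mem_ball_of_adj (by omega) hu'⟩
    have hu2 : (φ u).val = u' := by rw [hu]
    exact ⟨u, (hadj u).mp (hu2 ▸ hu'), hu2⟩
  have hidv : ident' v' = ident v := by rw [← hv, hid]
  have hlv : ∀ i, ℓ' i v' = ℓ i v := fun i => by rw [← hv, hl]
  obtain ⟨h1, h2, h3, h4⟩ := h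
  refine ⟨?_, ?_, ?_, ?_⟩
  · intro u' hu'
    obtain ⟨u, hu, rfl⟩ := hlift u' hu'
    rw [hl, hlv]
    exact h1 _ hu
  · intro hr
    rw [hidv, hlv] at hr
    obtain ⟨u, hu, hup⟩ := h2 hr
    refine ⟨(φ ⟨u, mem_ball_of_adj (by omega) hu⟩).val, (hadj _).mpr hu, ?_⟩
    rw [hid, hlv, hup]
  · rw [hlv, h3]
    congr 1
    simp only [relSum]
    refine Finset.sum_bij (fun u hu => (φ ⟨u, mem_ball_of_adj (by omega)
      (Finset.mem_filter.mp hu).2.1⟩).val) ?_ ?_ ?_ ?_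
    · intro u hu
      have hu2 := (Finset.mem_filter.mp hu).2
      rw [Finset.mem_filter]
      refine ⟨Finset.mem_univ _, (hadj _).mpr hu2.1, ?_⟩
      rw [hid, hl, hidv]
      exact hu2.2
    · intro u hu w hw huw
      simpa using φ.injective (Subtype.ext huw)
    · intro u' hu'
      have hu2 := (Finset.mem_filter.mp hu').2
      obtain ⟨u, hu, rfl⟩ := hlift u' hu2.1
      refine ⟨u.val, ?_, rfl⟩
      rw [Finset.mem_filter]
      refine ⟨Finset.mem_univ _, hu, ?_⟩
      have := hu2.2
      rwa [hid, hl, hidv] at this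
    · intro u hu
      rw [hl]
  · intro hr
    rw [hidv, hlv] at hr
    obtain ⟨ψ, hψ⟩ := exists_ballIso_restrict (Nat.le_succ A.t) φ hv
    rw [hlv, ← h4 hr]
    refine (A.isLocal C C' ident ident' _ _ v v' ψ ?_ ?_ ?_ ?_).symm
    · rw [hψ]
      exact hv
    · intro u
      rw [hψ, hx]
    · intro u
      rw [hψ, hid]
    · intro i u
      simp only [truncLabels]
      rw [hψ, hl]

open Classical in
/-- The local algorithm certifying that `A` rejects. -/
noncomputable def certAlg (A : LocalAlg) (c k : ℕ) : LocalAlg where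
  t := A.t + 1
  run C ident ℓs v := decide (certOK A c k C ident ℓs v)
  isLocal := by
    intro C C' ident ident' ℓ ℓ' v v' φ hv hx hid hl
    refine decide_eq_decide.mpr
      ⟨certOK_of_ballIso A c k C C' ident ident' ℓ ℓ' v v' φ hv hx hid hl,
      certOK_of_ballIso A c k C' C ident' ident ℓ' ℓ v' v φ.symm ?_ ?_ ?_ ?_⟩
    · have : φ.symm ⟨v', self_mem_ball C' v' (A.t + 1)⟩ = ⟨v, self_mem_ball C v (A.t + 1)⟩ := by
        rw [RelIso.symm_apply_eq]
        exact Subtype.ext hv.symm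
      rw [this]
    · intro u
      simpa using (hx (φ.symm u)).symm
    · intro u
      simpa using (hid (φ.symm u)).symm
    · intro i u
      simpa using (hl i (φ.symm u)).symm

lemma accepts_certAlg {A : LocalAlg} {c k : ℕ} {C : Config} {ident : Fin C.n → ℕ}
    {ℓs : ℕ → Fin C.n → List Bool} :
    accepts (certAlg A c k) C ident ℓs ↔ ∀ v, certOK A c k C ident ℓs v := by
  simp [accepts, certAlg]

lemma SimpleGraph.Connected.eq_of_forall_adj {V α : Type*} {G : SimpleGraph V}
    (hG : G.Connected) {f : V → α} (hf : ∀ v u, G.Adj v u → f u = f v) (v u : V) : f u = f v := by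
  obtain ⟨q⟩ := hG v u
  induction q with
  | nil => rfl
  | cons h _ ih => exact ih.trans (hf _ _ h)

lemma exists_reject_of_certOK {A : LocalAlg} {c k : ℕ} {C : Config} {ident : Fin C.n → ℕ}
    (hinj : Function.Injective ident) {ℓs : ℕ → Fin C.n → List Bool}
    (h : ∀ v, certOK A c k C ident ℓs v) :
    ∃ v, A.run C ident (truncLabels k (c * Nat.log 2 C.n) ℓs) v = false := by
  classical
  have hconst := C.conn.eq_of_forall_adj (f := fun v => certRoot (ℓs k v)) fun v => (h v).1
  choose! p hp using fun v => (h v).2.1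
  have hsum := sum_roots_eq_card (fun v => ident v = certRoot (ℓs k v)) p
    (fun v => certSize (ℓs k v)) (by
      intro v
      rw [(h v).2.2.1]
      congr 2
      funext u w
      refine propext ⟨?_, ?_⟩
      · rintro ⟨-, hr, hpw⟩
        exact ⟨hr, hinj ((hp u hr).2.trans hpw)⟩
      · rintro ⟨hr, rfl⟩
        exact ⟨(hp u hr).1.symm, hr, (hp u hr).2.symm⟩)
  have hne : (Finset.univ.filter fun v => ident v = certRoot (ℓs k v)).Nonempty := by
    rw [Finset.nonempty_iff_ne_empty]
    intro he
    have := C.npos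
    rw [he] at hsum
    simp at hsum
    omega
  obtain ⟨r, hr⟩ := hne
  have hr2 := (Finset.mem_filter.mp hr).2
  have hsing : (Finset.univ.filter fun v => ident v = certRoot (ℓs k v)) = {r} := by
    refine Finset.eq_singleton_iff_unique_mem.mpr ⟨hr, fun v hv => hinj ?_⟩
    rw [(Finset.mem_filter.mp hv).2, hr2]
    exact hconst r v
  rw [hsing, Finset.sum_singleton, Fintype.card_fin] at hsum
  refine ⟨r, ?_⟩
  have := (h r).2.2.2 hr2
  rwa [hsum] at this

lemma exists_certOK_of_reject {A : LocalAlg} {c k β : ℕ} (hβ : 1 ≤ β) {C : Config}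
    {ident : Fin C.n → ℕ} (hid : IsIdAssignment β C ident) {ℓs : ℕ → Fin C.n → List Bool}
    {r : Fin C.n} (hr : A.run C ident (truncLabels k (c * Nat.log 2 C.n) ℓs) r = false) :
    ∃ ℓ, goodLabel (c + 8 * β) C ℓ ∧
      ∀ v, certOK A c k C ident (Function.update ℓs k ℓ) v := by
  classical
  obtain ⟨p, s, hp, hs, hle, hsr⟩ := exists_rootedTree C.conn r
  rw [Fintype.card_fin] at hsr
  refine ⟨fun v => certCode (ident r) (ident (p v)) (s v), fun v => ?_, fun v => ?_⟩
  · have h1 : s v ≤ C.n ^ β := by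
      have := hle v
      rw [Fintype.card_fin] at this
      exact this.trans (Nat.le_self_pow (by omega) _)
    refine (length_certCode_le C.npos (hid.2 r).2 (hid.2 (p v)).2 h1).trans ?_
    exact Nat.mul_le_mul_right _ (Nat.le_add_left _ _)
  · have hs1 : ∀ u, 1 ≤ s u := fun u => by rw [hs u]; omega
    have hR := fun u => certRoot_certCode (ident (p u)) (s u) (hid.2 r).1
    have hP := fun u => certParent_certCode (ident r) (s u) (hid.2 (p u)).1
    have hS := fun u => certSize_certCode (ident r) (ident (p u)) (hs1 u)
    simp only [certOK, Function.update_self, hR, hP, hS, hid.1.eq_iff, ne_eq]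
    refine ⟨fun _ _ => trivial, fun hv => ⟨p v, hp v hv, rfl⟩, ?_, ?_⟩
    · refine (hs v).trans ?_
      congr 2
      funext u w
      refine propext ⟨?_, fun h => h.2⟩
      rintro ⟨hu, rfl⟩
      exact ⟨(hp u hu).symm, hu, rfl⟩
    · rintro rfl
      rw [hsr, ← hr]
      congr 1
      funext i u
      by_cases hi : i < k
      · simp [truncLabels, hi, Function.update_of_ne hi.ne]
      · simp [truncLabels, hi]

lemma truncLabels_update_self {V : Type*} (k m : ℕ) (ℓs : ℕ → V → List Bool)
    (ℓ : V → List Bool) : truncLabels k m (Function.update ℓs k ℓ) = truncLabels k m ℓs := by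
  funext i u
  by_cases hi : i < k
  · simp [truncLabels, hi, Function.update_of_ne hi.ne]
  · simp [truncLabels, hi]

lemma truncLabels_update_of_lt {V : Type*} {k i : ℕ} (hi : i < k) (m : ℕ)
    (ℓs : ℕ → V → List Bool) (ℓ : V → List Bool) :
    truncLabels k m (Function.update ℓs i ℓ) =
      Function.update (truncLabels k m ℓs) i (fun u => (ℓ u).take m) := by
  funext j u
  by_cases hj : j = i
  · subst hj
    simp [truncLabels, hi]
  · simp [truncLabels, Function.update_of_ne hj]

lemma not_altQ {c : ℕ} {C : Config} {P : (ℕ → Fin C.n → List Bool) → Prop} {j i : ℕ} {b : Bool}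
    {ℓs : ℕ → Fin C.n → List Bool} :
    ¬ altQ c C P j i b ℓs ↔ altQ c C (fun ℓs => ¬ P ℓs) j i (!b) ℓs := by
  induction j generalizing i b ℓs with
  | zero => rfl
  | succ j ih =>
    cases b
    · simp only [altQ, not_forall, ih, Bool.not_true, Bool.not_false, exists_prop]
    · simp only [altQ, not_exists, not_and, ih, Bool.not_true, Bool.not_false]

/-- A trailing existential quantifier can be moved into the matrix. -/
lemma altQ_succ_iff {c : ℕ} {C : Config} {P : (ℕ → Fin C.n → List Bool) → Prop} {k i : ℕ}
    {ℓs : ℕ → Fin C.n → List Bool} :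
    altQ c C P (k + 1) i (startEx (k + 1)) ℓs ↔
      altQ c C (fun ℓs => ∃ ℓ, goodLabel c C ℓ ∧ P (Function.update ℓs (i + k) ℓ))
        k i (startEx (k + 1)) ℓs := by
  induction k generalizing i ℓs with
  | zero => simp [altQ, startEx]
  | succ k ih =>
    have hb : startEx (k + 1 + 1) = !startEx (k + 1) := by
      simp only [startEx]
      rcases Nat.mod_two_eq_zero_or_one k with h | h <;> simp [Nat.add_mod, h]
    have hi : i + (k + 1) = i + 1 + k := by omega
    rw [hb, hi]
    cases hc : startEx (k + 1) <;> rw [hc] at ih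
    · rw [Bool.not_false, altQ, altQ]
      simp only [ih]
    · rw [Bool.not_true, altQ, altQ]
      simp only [ih]

/-- Quantifying over longer labels that are truncated afterwards changes nothing. -/
lemma altQ_truncLabels_iff {c c' : ℕ} (hc : c ≤ c') {C : Config}
    {P : (ℕ → Fin C.n → List Bool) → Prop} {k j i : ℕ} {b : Bool} (hij : i + j ≤ k)
    {ℓs : ℕ → Fin C.n → List Bool} :
    altQ c' C (fun ℓs => P (truncLabels k (c * Nat.log 2 C.n) ℓs)) j i b ℓs ↔
      altQ c C P j i b (truncLabels k (c * Nat.log 2 C.n) ℓs) := by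
  have hgood : ∀ ℓ, goodLabel c C ℓ → goodLabel c' C ℓ := fun ℓ h v =>
    (h v).trans (Nat.mul_le_mul_right _ hc)
  have htake : ∀ ℓ : Fin C.n → List Bool,
      goodLabel c C (fun u => (ℓ u).take (c * Nat.log 2 C.n)) := fun ℓ v => by simp
  have heq : ∀ ℓ, goodLabel c C ℓ → (fun u => (ℓ u).take (c * Nat.log 2 C.n)) = ℓ :=
    fun ℓ h => funext fun u => List.take_of_length_le (h u)
  induction j generalizing i b ℓs with
  | zero => rfl
  | succ j ih =>
    have hi : i < k := by omega
    cases b <;> simp only [altQ, ih (show i + 1 + j ≤ k by omega), truncLabels_update_of_lt hi]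
    · refine ⟨fun h ℓ hℓ => ?_, fun h ℓ _ => h _ (htake ℓ)⟩
      have := h ℓ (hgood ℓ hℓ)
      rwa [heq ℓ hℓ] at this
    · refine ⟨fun ⟨ℓ, _, h⟩ => ⟨_, htake ℓ, h⟩, fun ⟨ℓ, hℓ, h⟩ => ⟨ℓ, hgood ℓ hℓ, ?_⟩⟩
      rwa [heq ℓ hℓ]

lemma LambdaC_iff {α β k : ℕ} {L : Set Config} :
    LambdaC α β k L ↔ ∃ (A : LocalAlg) (c : ℕ), ∀ C : Config, BoundedInput α C →
      ∀ ident : Fin C.n → ℕ, IsIdAssignment β C ident →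
        (C ∈ L ↔ altQ c C (accepts A C ident) k 0 (startEx k) (noLabels C)) := by
  by_cases hk : k % 2 = 1
  · simp [LambdaC, hk, startEx, SigmaC]
  · simp [LambdaC, hk, startEx, PiC]

/-- For every `k ≥ 0`, `Λ_k ⊆ co-Λ_{k+1}`. -/
theorem Lambda_subset_coLambda_succ (α β : ℕ) (hβ : 1 ≤ β) (k : ℕ)
    (L : Set Config) (hL : IsDistLang α L) (h : LambdaC α β k L) :
    coLambdaC α β (k + 1) L := by
  obtain ⟨A, c, hA⟩ := LambdaC_iff.mp h
  refine LambdaC_iff.mpr ⟨certAlg A c k, c + 8 * β, fun C hC ident hid => ?_⟩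
  have hb : startEx (k + 1) = !startEx k := by
    simp only [startEx]
    rcases Nat.mod_two_eq_zero_or_one k with h | h <;> simp [Nat.add_mod, h]
  have hmem : C ∈ {C : Config | BoundedInput α C} \ L ↔ ¬ C ∈ L := by simp [hC]
  have hnone : truncLabels k (c * Nat.log 2 C.n) (noLabels C) = noLabels C := by
    funext i u
    simp [truncLabels, noLabels]
  rw [hmem, hA C hC ident hid, not_altQ, ← hb, altQ_succ_iff]
  conv_lhs => rw [← hnone]
  rw [← altQ_truncLabels_iff (Nat.le_add_right c (8 * β)) (Nat.zero_add k).le]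
  have hP : (fun ℓs => ¬ accepts A C ident (truncLabels k (c * Nat.log 2 C.n) ℓs)) =
      fun ℓs => ∃ ℓ, goodLabel (c + 8 * β) C ℓ ∧
        accepts (certAlg A c k) C ident (Function.update ℓs (0 + k) ℓ) := by
    funext ℓs
    simp only [Nat.zero_add, accepts_certAlg]
    refine propext ⟨fun hrej => ?_, fun ⟨ℓ, _, hok⟩ hacc => ?_⟩
    · obtain ⟨r, hr⟩ := not_forall.mp hrej
      exact exists_certOK_of_reject hβ hid (Bool.eq_false_iff.mpr hr)
    · obtain ⟨v, hv⟩ := exists_reject_of_certOK hid.1 hok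
      rw [truncLabels_update_self, hacc v] at hv
      exact Bool.noConfusion hv
  rw [hP]
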